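/- Let A, B, C, A', B', C' be vector spaces over a field and let 0 → A →^f B →^g C → 0 and 0 → C' →^u B' →^v A' → 0 be exact sequences of linear maps. Suppose φ_B : B → B' and φ_A : A → A' are linear isomorphisms satisfying v ∘ φ_B ∘ f = φ_A. Then the linear map T := g ∘ φ_B^{−1} ∘ u : C' → C is an isomorphism. -/

import Mathlib

/-- **The "zipping" lemma for a pair of short exact sequences.**
Given short exact sequences `0 → A → B → C → 0` and `0 → C' → B' → A' → 0` of vector
spaces, and isomorphisms `φ_B : B ≃ B'`, `φ_A : A ≃ A'` with `v ∘ φ_B ∘ f = φ_A`,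
the map `T = g ∘ φ_B⁻¹ ∘ u : C' → C` is an isomorphism. -/
theorem zipping_short_exact_sequences
    {K A B C A' B' C' : Type*} [Field K]
    [AddCommGroup A] [Module K A] [AddCommGroup B] [Module K B]
    [AddCommGroup C] [Module K C] [AddCommGroup A'] [Module K A']
    [AddCommGroup B'] [Module K B'] [AddCommGroup C'] [Module K C']
    (f : A →ₗ[K] B) (g : B →ₗ[K] C) (u : C' →ₗ[K] B') (v : B' →ₗ[K] A')
    (hf : Function.Injective f) (hg : Function.Surjective g)
    (hfg : LinearMap.range f = LinearMap.ker g)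
    (hu : Function.Injective u) (hv : Function.Surjective v)
    (huv : LinearMap.range u = LinearMap.ker v)
    (φB : B ≃ₗ[K] B') (φA : A ≃ₗ[K] A')
    (hcomm : ∀ a : A, v (φB (f a)) = φA a) :
    Function.Bijective (g ∘ₗ (φB.symm.toLinearMap) ∘ₗ u) := by
  have hgf : ∀ a, g (f a) = 0 := fun a => hfg.le ⟨a, rfl⟩
  have hvu : ∀ c, v (u c) = 0 := fun c => huv.le ⟨c, rfl⟩
  constructor
  · refine (injective_iff_map_eq_zero _).2 fun c hc => ?_
    obtain ⟨a, ha⟩ : φB.symm (u c) ∈ LinearMap.range f := hfg.ge hc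
    have ha₀ : a = 0 := by
      apply φA.map_eq_zero_iff.1
      rw [← hcomm, ha, φB.apply_symm_apply, hvu]
    apply hu
    apply φB.symm.injective
    rw [← ha, ha₀]
    simp
  · intro c
    obtain ⟨b, rfl⟩ := hg c
    obtain ⟨c', hc'⟩ : φB (b - f (φA.symm (v (φB b)))) ∈ LinearMap.range u := by
      rw [huv, LinearMap.mem_ker, map_sub, map_sub, hcomm, φA.apply_symm_apply, sub_self]
    refine ⟨c', ?_⟩
    simp [hc', hgf]
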